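/- arXiv:math/0005113 — 2 statements merged into one kernel-verified Lean document; each statement's English description precedes it below -/
import Mathlib

section
/- If ω ∈ Ω̂ is an r-homogeneous sequence (r ≥ 3), then the growth function of the spinal group G_ω satisfies γ_ω(n) ≾ e^{n^α}, where α = log(q)/(log(q) − log(η_r)) and η_r is the unique root in (0,1) of the polynomial x^r + x^{r−1} + x^{r−2} − 2. -/
noncomputable section

open Equiv

namespace Spinal

/-- The letter `q` of the alphabet `{1,…,q}` (here `q = m + 2`). -/
def qtop (m : ℕ) : Fin (m + 2) := Fin.last (m + 1)

/-- The letter `1` of the alphabet. -/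
def qone (m : ℕ) : Fin (m + 2) := 0


theorem qone_ne_qtop (m : ℕ) : qone m ≠ qtop m := by
  simp [qone, qtop, Fin.ext_iff]

/-- The action of an alphabet permutation on the first letter of a word. -/
def rootFun (m : ℕ) (a : Equiv.Perm (Fin (m + 2))) :
    List (Fin (m + 2)) → List (Fin (m + 2))
  | [] => []
  | y :: w => a y :: w

theorem rootFun_leftInv (m : ℕ) (a : Equiv.Perm (Fin (m + 2))) (w : List (Fin (m + 2))) :
    rootFun m a.symm (rootFun m a w) = w := by
  cases w <;> simp [rootFun]

/-- The tree automorphism induced by a root permutation. -/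
def rootAut (m : ℕ) (a : Equiv.Perm (Fin (m + 2))) : Equiv.Perm (List (Fin (m + 2))) where
  toFun := rootFun m a
  invFun := rootFun m a.symm
  left_inv w := rootFun_leftInv m a w
  right_inv w := by simpa using rootFun_leftInv m a.symm w

variable {GB : Type*} [Group GB]

/-- The spinal action of `b : G_B` determined by the sequence `ω` of homomorphisms:
at the vertex `q^n 1` the next letter is moved by `ω n b` (0-indexed, so `ω 0` is the
paper's `ω₁`). -/
def spinalFun (m : ℕ) (ω : ℕ → GB →* Equiv.Perm (Fin (m + 2))) (b : GB) :
    ℕ → List (Fin (m + 2)) → List (Fin (m + 2))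
  | _, [] => []
  | n, y :: w =>
    if y = qtop m then y :: spinalFun m ω b (n + 1) w
    else if y = qone m then
      y :: (match w with
            | [] => []
            | z :: w' => ω n b z :: w')
    else y :: w

theorem spinalFun_leftInv (m : ℕ) (ω : ℕ → GB →* Equiv.Perm (Fin (m + 2)))
    (b : GB) (n : ℕ) (w : List (Fin (m + 2))) :
    spinalFun m ω b⁻¹ n (spinalFun m ω b n w) = w := by
  induction w generalizing n with
  | nil => simp [spinalFun]
  | cons y w ih =>
    by_cases h1 : y = qtop m
    · simp [spinalFun, h1, ih]
    · by_cases h2 : y = qone m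
      · match w with
        | [] => simp [spinalFun, h1, h2]
        | z :: w' => simp [spinalFun, h1, h2, map_inv, qone_ne_qtop]
      · simp [spinalFun, h1, h2]

/-- The tree automorphism induced by `b : G_B` via the sequence `ω`. -/
def spinalAut (m : ℕ) (ω : ℕ → GB →* Equiv.Perm (Fin (m + 2))) (b : GB) :
    Equiv.Perm (List (Fin (m + 2))) where
  toFun := spinalFun m ω b 0
  invFun := spinalFun m ω b⁻¹ 0
  left_inv w := spinalFun_leftInv m ω b 0 w
  right_inv w := by simpa using spinalFun_leftInv m ω b⁻¹ 0 w

/-- The canonical generating set `S_ω = A ∪ B_ω` (non-identity induced automorphisms). -/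
def genSet (m : ℕ) (GA : Subgroup (Equiv.Perm (Fin (m + 2))))
    (ω : ℕ → GB →* Equiv.Perm (Fin (m + 2))) : Set (Equiv.Perm (List (Fin (m + 2)))) :=
  ((rootAut m '' (GA : Set (Equiv.Perm (Fin (m + 2))))) ∪
    Set.range fun b : GB => spinalAut m ω b) \ {1}

/-- The spinal group `G_ω`, as a subgroup of the permutation group of the vertex set
of the `(m+2)`-regular rooted tree. -/
def spinalGroup (m : ℕ) (GA : Subgroup (Equiv.Perm (Fin (m + 2))))
    (ω : ℕ → GB →* Equiv.Perm (Fin (m + 2))) : Subgroup (Equiv.Perm (List (Fin (m + 2)))) :=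
  Subgroup.closure (genSet m GA ω)

/-- The defining conditions on the data `(G_A, G_B, ω)` of a spinal group:
`G_A` is a transitive (hence faithful) group of permutations of the alphabet,
every `ω n` is an epimorphism onto `G_A`, and `ω ∈ Ω̂`: from every index on, the kernels
of the remaining homomorphisms cover `G_B` and intersect trivially. -/
structure SpinalData (m : ℕ) (GA : Subgroup (Equiv.Perm (Fin (m + 2))))
    (ω : ℕ → GB →* Equiv.Perm (Fin (m + 2))) : Prop where
  transitive : ∀ i j : Fin (m + 2), ∃ a ∈ GA, a i = j
  range_eq : ∀ n, (ω n).range = GA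
  kernels_cover : ∀ i : ℕ, ∀ b : GB, ∃ j, i ≤ j ∧ ω j b = 1
  kernels_sep : ∀ i : ℕ, ∀ b : GB, (∀ j, i ≤ j → ω j b = 1) → b = 1

/-- Word length of a group element with respect to a set of generators. -/
def wordLength {G : Type*} [Group G] (S : Set G) (g : G) : ℕ :=
  sInf {n | ∃ l : List G, l.length = n ∧ (∀ x ∈ l, x ∈ S) ∧ l.prod = g}

/-- The word growth function `γ_ω` of the spinal group with respect to `S_ω`. -/
def growth (m : ℕ) (GA : Subgroup (Equiv.Perm (Fin (m + 2))))
    (ω : ℕ → GB →* Equiv.Perm (Fin (m + 2))) (n : ℕ) : ℕ :=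
  Nat.card {g : Equiv.Perm (List (Fin (m + 2))) //
    g ∈ spinalGroup m GA ω ∧ wordLength (genSet m GA ω) g ≤ n}

/-- The period growth function `π_ω`: the largest order of an element of word length
at most `n`. -/
def periodGrowth (m : ℕ) (GA : Subgroup (Equiv.Perm (Fin (m + 2))))
    (ω : ℕ → GB →* Equiv.Perm (Fin (m + 2))) (n : ℕ) : ℕ :=
  sSup (orderOf '' {g : Equiv.Perm (List (Fin (m + 2))) |
    g ∈ spinalGroup m GA ω ∧ wordLength (genSet m GA ω) g ≤ n})

/-- Abstract letters for words over `S_ω`: an `A`-letter is (induced by) a permutation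
of the alphabet, a `B`-letter is (induced by) an element of `G_B`. -/
abbrev Letter (m : ℕ) (GB : Type*) := Equiv.Perm (Fin (m + 2)) ⊕ GB

/-- Evaluation of an abstract letter as a tree automorphism. -/
def evalLetter (m : ℕ) (ω : ℕ → GB →* Equiv.Perm (Fin (m + 2))) :
    Letter m GB → Equiv.Perm (List (Fin (m + 2))) :=
  Sum.elim (rootAut m) (spinalAut m ω)

/-- The list of `A`-letters of a word, in order. -/
def aLetters {m : ℕ} {GB : Type*} : List (Letter m GB) → List (Equiv.Perm (Fin (m + 2))) :=
  List.filterMap fun x => match x with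
    | Sum.inl a => some a
    | Sum.inr _ => none

/-- The list of `B`-letters of a word, in order. -/
def bLetters {m : ℕ} {GB : Type*} : List (Letter m GB) → List GB :=
  List.filterMap fun x => match x with
    | Sum.inl _ => none
    | Sum.inr b => some b

/-- A word is reduced if its letters alternate between `A`-letters and `B`-letters and
no letter is the identity. -/
def IsReduced {m : ℕ} (F : List (Letter m GB)) : Prop :=
  List.Chain' (fun x y => x.isLeft ≠ y.isLeft) F ∧
    Sum.inl (1 : Equiv.Perm (Fin (m + 2))) ∉ F ∧ Sum.inr (1 : GB) ∉ F

open scoped Classical in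
/-- One step of the (complete, confluent) simple reduction process: prepend a letter to an
already reduced word and reduce. -/
def reduceStep {m : ℕ} : Letter m GB → List (Letter m GB) → List (Letter m GB)
  | Sum.inl a, [] => if a = 1 then [] else [Sum.inl a]
  | Sum.inr b, [] => if b = 1 then [] else [Sum.inr b]
  | Sum.inl a, Sum.inl a' :: t => if a * a' = 1 then t else Sum.inl (a * a') :: t
  | Sum.inr b, Sum.inr b' :: t => if b * b' = 1 then t else Sum.inr (b * b') :: t
  | Sum.inl a, y :: t => if a = 1 then y :: t else Sum.inl a :: y :: t
  | Sum.inr b, y :: t => if b = 1 then y :: t else Sum.inr b :: y :: t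

/-- The reduced form of a word, obtained by simple reductions. -/
def reduceWord {m : ℕ} (F : List (Letter m GB)) : List (Letter m GB) :=
  F.foldr reduceStep []

open scoped Classical in
/-- The (unreduced) projection of a word, representing an element of the first-level
stabilizer, to the coordinate `i` of the first level: scanning the word from the left
while accumulating the product `g` of the `A`-letters, a `B`-letter `b` contributes the
letter `b` at the coordinate `g(q)` and the letter `ω₁(b)` at the coordinate `g(1)`. -/
def projWord (m : ℕ) (ω0 : GB →* Equiv.Perm (Fin (m + 2))) (i : Fin (m + 2)) :
    List (Letter m GB) → Equiv.Perm (Fin (m + 2)) → List (Letter m GB)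
  | [], _ => []
  | Sum.inl a :: F, g => projWord m ω0 i F (g * a)
  | Sum.inr b :: F, g =>
      ((if g (qtop m) = i then [Sum.inr b] else []) ++
        (if g (qone m) = i then [Sum.inl (ω0 b)] else [])) ++ projWord m ω0 i F g

/-- The list of the `q^r` (reduced) words at level `r` of the depth-`r` decomposition
of a word. -/
def levelWords (m : ℕ) :
    (ℕ → GB →* Equiv.Perm (Fin (m + 2))) → ℕ → List (Letter m GB) →
      List (List (Letter m GB))
  | _, 0, F => [F]
  | ω, r + 1, F =>
      (List.finRange (m + 2)).flatMap fun i =>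
        levelWords m (fun n => ω (n + 1)) r (reduceWord (projWord m (ω 0) i F 1))

/-- `|L_r(F)|`: the total length of level `r` of the depth-`r` decomposition of `F`. -/
def levelLength (m : ℕ) (ω : ℕ → GB →* Equiv.Perm (Fin (m + 2))) (r : ℕ)
    (F : List (Letter m GB)) : ℕ :=
  ((levelWords m ω r F).map List.length).sum

/-- The triangular weight of a letter: `A`-letters have weight `τ₀ = 1 - η^r`; a
`B`-letter `b` has weight `τ_i = η^r + η^(r-i) - 1` where `i` is the smallest (1-based)
index with `ω_i(b) = 1`. -/
def letterWeight (m : ℕ) (ω : ℕ → GB →* Equiv.Perm (Fin (m + 2))) (η : ℝ) (r : ℕ) :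
    Letter m GB → ℝ
  | Sum.inl _ => 1 - η ^ r
  | Sum.inr b => η ^ r + η ^ (r - (sInf {j | ω j b = 1} + 1)) - 1

/-- The total triangular weight of a word. -/
def wordWeight (m : ℕ) (ω : ℕ → GB →* Equiv.Perm (Fin (m + 2))) (η : ℝ) (r : ℕ)
    (F : List (Letter m GB)) : ℝ :=
  (F.map (letterWeight m ω η r)).sum

/-- The weight `∂^τ(g)` of a group element: the least total weight of a word over `S_ω`
representing it. -/
def elemWeight (m : ℕ) (GA : Subgroup (Equiv.Perm (Fin (m + 2))))
    (ω : ℕ → GB →* Equiv.Perm (Fin (m + 2))) (η : ℝ) (r : ℕ)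
    (g : Equiv.Perm (List (Fin (m + 2)))) : ℝ :=
  sInf {x : ℝ | ∃ F : List (Letter m GB),
    (∀ a : Equiv.Perm (Fin (m + 2)), Sum.inl a ∈ F → a ∈ GA) ∧
    (F.map (evalLetter m ω)).prod = g ∧ wordWeight m ω η r F = x}

theorem rpow_exponent_bounds {q η : ℝ} (hq : 2 ≤ q) (hη0 : 0 < η) (hη1 : η < 1) :
    0 < Real.log q / (Real.log q - Real.log η) ∧
      Real.log q / (Real.log q - Real.log η) < 1 := by
  have h1 : 0 < Real.log q := Real.log_pos (by linarith)
  have h2 : Real.log η < 0 := Real.log_neg hη0 hη1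
  refine ⟨div_pos h1 (by linarith), ?_⟩
  rw [div_lt_one (by linarith)]
  linarith

theorem mul_div_rpow_exponent {q η : ℝ} (hq : 2 ≤ q) (hη0 : 0 < η) (hη1 : η < 1) :
    q * (η / q) ^ (Real.log q / (Real.log q - Real.log η)) = 1 := by
  have hq0 : 0 < q := by linarith
  have h1 : 0 < Real.log q := Real.log_pos (by linarith)
  have h2 : Real.log η < 0 := Real.log_neg hη0 hη1
  have h3 : Real.log q - Real.log η ≠ 0 := by linarith
  rw [Real.rpow_def_of_pos (div_pos hη0 hq0), Real.log_div hη0.ne' hq0.ne']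
  nth_rewrite 1 [← Real.exp_log hq0]
  rw [← Real.exp_add, Real.exp_eq_one_iff]
  field_simp
  ring

/-- The function `x ↦ 3 (x + 1) ^ α - 2` is contracted, up to an additive gain of one, by
passing to `q` arguments with mean `(η x + c) / q`. -/
theorem eventually_rpow_contraction {q η c : ℝ} (hq : 2 ≤ q) (hη0 : 0 < η) (hη1 : η < 1)
    (hc : 0 ≤ c) {α : ℝ} (hα : α = Real.log q / (Real.log q - Real.log η)) :
    ∃ N : ℝ, ∀ x : ℝ, N ≤ x →
      q * (3 * ((η * x + c) / q + 1) ^ α - 2) + 1 ≤ 3 * (x + 1) ^ α - 2 := by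
  obtain ⟨hα0, hα1⟩ := rpow_exponent_bounds hq hη0 hη1
  have hmul := mul_div_rpow_exponent hq hη0 hη1
  rw [← hα] at hα0 hα1 hmul
  have hq0 : 0 < q := by linarith
  set d : ℝ := (c + q) / η - 1 with hd
  have hd0 : 0 ≤ d := by
    rw [hd, sub_nonneg, le_div_iff₀ hη0]; linarith
  have hlim : Filter.Tendsto (fun y : ℝ => 3 * (α * d) * y ^ (-(1 - α))) Filter.atTop
      (nhds (3 * (α * d) * 0)) :=
    (tendsto_rpow_neg_atTop (by linarith)).const_mul _
  rw [mul_zero] at hlim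
  obtain ⟨N, hN⟩ := Filter.eventually_atTop.1 (hlim.eventually (gt_mem_nhds one_pos))
  refine ⟨max N 0, fun x hx => ?_⟩
  have hx0 : 0 ≤ x := (le_max_right _ _).trans hx
  have hx1 : 0 < x + 1 := by linarith
  have hsmall := hN (x + 1) (by linarith [(le_max_left N 0).trans hx])
  have hrw : (η * x + c) / q + 1 = η / q * (x + 1 + d) := by
    rw [hd]; field_simp; ring
  have hbern : (x + 1 + d) ^ α ≤ (x + 1) ^ α + α * d * (x + 1) ^ (-(1 - α)) := by
    have h1 : x + 1 + d = (x + 1) * (1 + d / (x + 1)) := by field_simp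
    have hs : 0 ≤ d / (x + 1) := by positivity
    have h2 : (1 + d / (x + 1)) ^ α ≤ 1 + α * (d / (x + 1)) :=
      rpow_one_add_le_one_add_mul_self (by linarith) hα0.le hα1.le
    have h3 : (x + 1) ^ (-(1 - α)) = (x + 1) ^ α / (x + 1) := by
      rw [show -(1 - α) = α - 1 by ring, Real.rpow_sub_one hx1.ne']
    rw [h1, Real.mul_rpow hx1.le (by linarith), h3]
    calc (x + 1) ^ α * (1 + d / (x + 1)) ^ α
        ≤ (x + 1) ^ α * (1 + α * (d / (x + 1))) := by gcongr
      _ = _ := by ring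
  rw [hrw, Real.mul_rpow (by positivity) (by linarith)]
  have hexp : q * (3 * ((η / q) ^ α * (x + 1 + d) ^ α) - 2) + 1 =
      3 * (q * (η / q) ^ α) * (x + 1 + d) ^ α - 2 * q + 1 := by ring
  rw [hexp, hmul]
  linarith

theorem sum_rpow_le_card_mul_rpow_mean {m : ℕ} {α : ℝ} (hα0 : 0 ≤ α) (hα1 : α ≤ 1)
    (x : Fin (m + 2) → ℝ) (hx : ∀ i, 0 ≤ x i) :
    ∑ i, (x i + 1) ^ α ≤ ((m : ℝ) + 2) * ((∑ i, x i) / ((m : ℝ) + 2) + 1) ^ α := by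
  have hq : (0 : ℝ) < (m : ℝ) + 2 := by positivity
  have h := (Real.concaveOn_rpow hα0 hα1).le_map_sum (t := Finset.univ)
    (w := fun _ : Fin (m + 2) => ((m : ℝ) + 2)⁻¹) (p := fun i => x i + 1)
    (fun _ _ => by positivity) (by simp; field_simp)
    (fun i _ => by simpa using add_nonneg (hx i) zero_le_one)
  simp only [smul_eq_mul, ← Finset.mul_sum] at h
  rw [inv_mul_le_iff₀ hq] at h
  refine h.trans_eq ?_
  congr 2
  rw [Finset.sum_add_distrib]
  simp
  field_simp

/-- A Kraft-type inequality for a family of weighted sets closed under a contracting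
decomposition into `m + 2` pieces. -/
theorem exists_kraft_inequality {G P : Type*} [Finite P] {m : ℕ} {η c α : ℝ}
    (hη0 : 0 < η) (hη1 : η < 1) (hc : 0 ≤ c)
    (hα : α = Real.log ((m : ℝ) + 2) / (Real.log ((m : ℝ) + 2) - Real.log η))
    (X : ℕ → Set G) (w : ℕ → G → ℕ) (d : ℕ → G → P × (Fin (m + 2) → G))
    (hinj : ∀ k, Set.InjOn (d k) (X k))
    (hmem : ∀ k, ∀ g ∈ X k, ∀ i, (d k g).2 i ∈ X (k + 1))
    (hw : ∀ k, ∀ g ∈ X k, ∑ i, (w (k + 1) ((d k g).2 i) : ℝ) ≤ η * w k g + c)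
    (hsmall : ∀ N : ℕ, ∃ L : ℕ, ∀ k, ∀ S : Finset G,
      (∀ g ∈ S, g ∈ X k ∧ w k g ≤ N) → S.card ≤ L) :
    ∃ E : ℝ, 0 < E ∧ ∀ k, ∀ S : Finset G, (∀ g ∈ S, g ∈ X k) →
      ∑ g ∈ S, Real.exp (-(E * (3 * ((w k g : ℝ) + 1) ^ α - 2))) ≤ 1 := by
  classical
  have hq : (2 : ℝ) ≤ (m : ℝ) + 2 := by linarith [Nat.cast_nonneg (α := ℝ) m]
  have hq0 : (0 : ℝ) < (m : ℝ) + 2 := by linarith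
  obtain ⟨hα0, hα1⟩ := rpow_exponent_bounds hq hη0 hη1
  rw [← hα] at hα0 hα1
  obtain ⟨N₁, hN₁⟩ := eventually_rpow_contraction hq hη0 hη1 hc hα
  obtain ⟨N, hN⟩ := exists_nat_ge (max N₁ ((c + 1) / (1 - η)))
  have hNc : ∀ n : ℕ, N ≤ n → η * n + c ≤ n - 1 := by
    intro n hn
    have h1 : (c + 1) / (1 - η) ≤ n :=
      (le_max_right _ _).trans (hN.trans (by exact_mod_cast hn))
    rw [div_le_iff₀ (by linarith)] at h1
    linarith
  obtain ⟨L, hL⟩ := hsmall N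
  have := Fintype.ofFinite P
  set ψ : ℝ → ℝ := fun x => 3 * (x + 1) ^ α - 2 with hψ
  have hψ1 : ∀ x : ℝ, 0 ≤ x → 1 ≤ ψ x := by
    intro x hx
    have := Real.one_le_rpow (show (1 : ℝ) ≤ x + 1 by linarith) hα0.le
    simp only [hψ]; linarith
  set M : ℝ := (L : ℝ) + Fintype.card P + 2 with hM
  have hM1 : 1 < M := by
    have : (0 : ℝ) ≤ (L : ℝ) + Fintype.card P := by positivity
    linarith
  set E : ℝ := Real.log M with hE
  have hE0 : 0 < E := Real.log_pos hM1
  have hEM : Real.exp (-E) * M = 1 := by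
    rw [Real.exp_neg, hE, Real.exp_log (by linarith), inv_mul_cancel₀ (by linarith)]
  refine ⟨E, hE0, ?_⟩
  have hdec : ∀ k, ∀ g ∈ X k, N ≤ w k g →
      ∑ i, ψ (w (k + 1) ((d k g).2 i)) + 1 ≤ ψ (w k g) := by
    intro k g hg hNg
    have hjen := sum_rpow_le_card_mul_rpow_mean hα0.le hα1.le
      (fun i => (w (k + 1) ((d k g).2 i) : ℝ)) (fun i => Nat.cast_nonneg _)
    have hcon := hN₁ (w k g) ((le_max_left _ _).trans (hN.trans (by exact_mod_cast hNg)))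
    have hmono : ((∑ i, (w (k + 1) ((d k g).2 i) : ℝ)) / ((m : ℝ) + 2) + 1) ^ α ≤
        ((η * w k g + c) / ((m : ℝ) + 2) + 1) ^ α := by
      have := hw k g hg
      gcongr
    have hmono' := mul_le_mul_of_nonneg_left hmono hq0.le
    simp only [hψ, Finset.sum_sub_distrib, ← Finset.mul_sum, Finset.sum_const,
      Finset.card_univ, Fintype.card_fin, nsmul_eq_mul]
    push_cast
    linarith
  have main : ∀ n : ℕ, ∀ k, ∀ S : Finset G, (∀ g ∈ S, g ∈ X k ∧ w k g ≤ n) →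
      ∑ g ∈ S, Real.exp (-(E * ψ (w k g))) ≤ 1 := by
    intro n
    induction n with
    | zero =>
      intro k S hS
      have hcard := hL k S fun g hg => ⟨(hS g hg).1, (hS g hg).2.trans (Nat.zero_le _)⟩
      calc ∑ g ∈ S, Real.exp (-(E * ψ (w k g))) ≤ ∑ g ∈ S, Real.exp (-E) := by
            refine Finset.sum_le_sum fun g _ => Real.exp_le_exp.2 (neg_le_neg ?_)
            exact le_mul_of_one_le_right hE0.le (hψ1 _ (Nat.cast_nonneg _))
        _ = Real.exp (-E) * S.card := by simp [mul_comm]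
        _ ≤ Real.exp (-E) * M := by
            have : (S.card : ℝ) ≤ L := by exact_mod_cast hcard
            have h0 : (0 : ℝ) ≤ Fintype.card P := by positivity
            gcongr
            linarith
        _ = 1 := hEM
    | succ n ih =>
      intro k S hS
      rw [← Finset.sum_filter_add_sum_filter_not S (fun g => w k g ≤ N)]
      have h1 : ∑ g ∈ S with w k g ≤ N, Real.exp (-(E * ψ (w k g))) ≤
          Real.exp (-E) * L := by
        have hcard := hL k (S.filter fun g => w k g ≤ N) fun g hg =>
          ⟨(hS g (Finset.mem_filter.1 hg).1).1, (Finset.mem_filter.1 hg).2⟩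
        calc ∑ g ∈ S with w k g ≤ N, Real.exp (-(E * ψ (w k g)))
            ≤ ∑ g ∈ S with w k g ≤ N, Real.exp (-E) := by
              refine Finset.sum_le_sum fun g _ => Real.exp_le_exp.2 (neg_le_neg ?_)
              exact le_mul_of_one_le_right hE0.le (hψ1 _ (Nat.cast_nonneg _))
          _ = Real.exp (-E) * (S.filter fun g => w k g ≤ N).card := by simp [mul_comm]
          _ ≤ _ := by gcongr
      have h2 : ∑ g ∈ S with ¬ w k g ≤ N, Real.exp (-(E * ψ (w k g))) ≤
          Real.exp (-E) * Fintype.card P := by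
        set S' := S.filter fun g => ¬ w k g ≤ N with hS'
        have hX : ∀ g ∈ S', g ∈ X k := fun g hg => (hS g (Finset.mem_filter.1 hg).1).1
        let T : Fin (m + 2) → Finset G := fun i => S'.image fun g => (d k g).2 i
        have hT : ∀ i, ∑ h ∈ T i, Real.exp (-(E * ψ (w (k + 1) h))) ≤ 1 := by
          refine fun i => ih (k + 1) (T i) fun h hh => ?_
          obtain ⟨g, hg, rfl⟩ := Finset.mem_image.1 hh
          refine ⟨hmem k g (hX g hg) i, ?_⟩
          have ha := hw k g (hX g hg)
          have hb := hNc (w k g) (not_le.1 (Finset.mem_filter.1 hg).2).le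
          have hc' : (w (k + 1) ((d k g).2 i) : ℝ) ≤ ∑ i, (w (k + 1) ((d k g).2 i) : ℝ) :=
            Finset.single_le_sum (f := fun i => (w (k + 1) ((d k g).2 i) : ℝ))
              (fun _ _ => Nat.cast_nonneg _) (Finset.mem_univ i)
          have hd' : (w k g : ℝ) ≤ n + 1 := by
            exact_mod_cast (hS g (Finset.mem_filter.1 hg).1).2
          have : (w (k + 1) ((d k g).2 i) : ℝ) ≤ n := by linarith
          exact_mod_cast this
        let f : P × (Fin (m + 2) → G) → ℝ := fun t =>
          ∏ i, Real.exp (-(E * ψ (w (k + 1) (t.2 i))))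
        calc ∑ g ∈ S', Real.exp (-(E * ψ (w k g)))
            ≤ ∑ g ∈ S', Real.exp (-E) * f (d k g) := by
              refine Finset.sum_le_sum fun g hg => ?_
              simp only [f]
              rw [← Real.exp_sum, ← Real.exp_add, Real.exp_le_exp, Finset.sum_neg_distrib,
                ← Finset.mul_sum]
              have := hdec k g (hX g hg) (not_le.1 (Finset.mem_filter.1 hg).2).le
              have := mul_le_mul_of_nonneg_left this hE0.le
              linarith
          _ = Real.exp (-E) * ∑ t ∈ S'.image (d k), f t := by
              rw [← Finset.mul_sum, Finset.sum_image]
              exact fun g hg h hh => hinj k (hX g hg) (hX h hh)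
          _ ≤ Real.exp (-E) * ∑ t ∈ (Finset.univ : Finset P) ×ˢ Fintype.piFinset T, f t := by
              gcongr
              intro t ht
              obtain ⟨g, hg, rfl⟩ := Finset.mem_image.1 ht
              simp only [Finset.mem_product, Finset.mem_univ, true_and, Fintype.mem_piFinset]
              exact fun i => Finset.mem_image.2 ⟨g, hg, rfl⟩
          _ = Real.exp (-E) * (Fintype.card P *
                ∏ i, ∑ h ∈ T i, Real.exp (-(E * ψ (w (k + 1) h)))) := by
              rw [Finset.sum_product, Finset.prod_univ_sum]
              simp [f]
          _ ≤ Real.exp (-E) * (Fintype.card P * 1) := by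
              gcongr
              exact Finset.prod_le_one (fun i _ => Finset.sum_nonneg fun _ _ => by positivity)
                fun i _ => hT i
          _ = _ := by rw [mul_one]
      calc _ ≤ Real.exp (-E) * L + Real.exp (-E) * Fintype.card P := add_le_add h1 h2
        _ ≤ Real.exp (-E) * M := by
            rw [← mul_add]; gcongr; linarith
        _ = 1 := hEM
  intro k S hS
  exact main (S.sup (w k)) k S fun g hg => ⟨hS g hg, Finset.le_sup hg⟩

theorem rootAut_one (m : ℕ) : rootAut m 1 = 1 := by
  ext1 w
  cases w <;> rfl

theorem rootAut_mul (m : ℕ) (a a' : Equiv.Perm (Fin (m + 2))) :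
    rootAut m (a * a') = rootAut m a * rootAut m a' := by
  ext1 w
  cases w <;> rfl

theorem spinalFun_mul (m : ℕ) (ω : ℕ → GB →* Equiv.Perm (Fin (m + 2))) (b b' : GB) (n : ℕ)
    (w : List (Fin (m + 2))) :
    spinalFun m ω (b * b') n w = spinalFun m ω b n (spinalFun m ω b' n w) := by
  induction w generalizing n with
  | nil => simp [spinalFun]
  | cons y w ih =>
    by_cases h1 : y = qtop m
    · simp [spinalFun, h1, ih]
    · by_cases h2 : y = qone m
      · cases w <;> simp [spinalFun, h2, qone_ne_qtop]
      · simp [spinalFun, h1, h2]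

theorem spinalAut_mul (m : ℕ) (ω : ℕ → GB →* Equiv.Perm (Fin (m + 2))) (b b' : GB) :
    spinalAut m ω (b * b') = spinalAut m ω b * spinalAut m ω b' := by
  ext1 w
  exact spinalFun_mul m ω b b' 0 w

theorem spinalAut_one (m : ℕ) (ω : ℕ → GB →* Equiv.Perm (Fin (m + 2))) :
    spinalAut m ω (1 : GB) = 1 := by
  have h := spinalAut_mul m ω (1 : GB) 1
  rw [mul_one] at h
  exact left_eq_mul.1 h

/-- The sequence of homomorphisms with its first term deleted. -/
def shift {m : ℕ} (ω : ℕ → GB →* Equiv.Perm (Fin (m + 2))) :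
    ℕ → GB →* Equiv.Perm (Fin (m + 2)) :=
  fun n => ω (n + 1)

theorem spinalFun_succ (m : ℕ) (ω : ℕ → GB →* Equiv.Perm (Fin (m + 2))) (b : GB) (n : ℕ)
    (w : List (Fin (m + 2))) :
    spinalFun m ω b (n + 1) w = spinalFun m (shift ω) b n w := by
  induction w generalizing n with
  | nil => simp [spinalFun]
  | cons y w ih => simp only [spinalFun, ih, shift]

/-- The tree automorphism represented by a word. -/
def evalWord (m : ℕ) (ω : ℕ → GB →* Equiv.Perm (Fin (m + 2))) (F : List (Letter m GB)) :
    Equiv.Perm (List (Fin (m + 2))) :=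
  (F.map (evalLetter m ω)).prod

theorem evalWord_cons (m : ℕ) (ω : ℕ → GB →* Equiv.Perm (Fin (m + 2))) (x : Letter m GB)
    (F : List (Letter m GB)) :
    evalWord m ω (x :: F) = evalLetter m ω x * evalWord m ω F := by
  simp [evalWord]

theorem evalWord_append (m : ℕ) (ω : ℕ → GB →* Equiv.Perm (Fin (m + 2)))
    (F F' : List (Letter m GB)) :
    evalWord m ω (F ++ F') = evalWord m ω F * evalWord m ω F' := by
  simp [evalWord]

/-- The permutation of the first level induced by a word. -/
def levelPerm {m : ℕ} : List (Letter m GB) → Equiv.Perm (Fin (m + 2))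
  | [] => 1
  | Sum.inl a :: F => a * levelPerm F
  | Sum.inr _ :: F => levelPerm F

open scoped Classical in
/-- The section of the `B`-letter `b` at the first-level vertex `j`, as a word. -/
def letterSection {m : ℕ} (ω0 : GB →* Equiv.Perm (Fin (m + 2))) (b : GB)
    (j : Fin (m + 2)) : List (Letter m GB) :=
  if j = qtop m then [Sum.inr b]
  else if j = qone m then (if ω0 b = 1 then [] else [Sum.inl (ω0 b)])
  else []

/-- The section of a word at the first-level vertex `i`, as a word. -/
def wordSection {m : ℕ} (ω0 : GB →* Equiv.Perm (Fin (m + 2))) (i : Fin (m + 2)) :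
    List (Letter m GB) → List (Letter m GB)
  | [] => []
  | Sum.inl _ :: F => wordSection ω0 i F
  | Sum.inr b :: F => letterSection ω0 b (levelPerm F i) ++ wordSection ω0 i F

theorem spinalAut_cons (m : ℕ) (ω : ℕ → GB →* Equiv.Perm (Fin (m + 2))) (b : GB)
    (j : Fin (m + 2)) (w : List (Fin (m + 2))) :
    spinalAut m ω b (j :: w) =
      j :: evalWord m (shift ω) (letterSection (ω 0) b j) w := by
  change spinalFun m ω b 0 (j :: w) = _
  by_cases h1 : j = qtop m
  · simp only [spinalFun, h1, if_true, letterSection, evalWord, evalLetter, List.map_cons,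
      List.map_nil, List.prod_singleton, Sum.elim_inr, spinalFun_succ]
    rfl
  · by_cases h2 : j = qone m
    · by_cases h3 : ω 0 b = 1
      · cases w <;> simp [spinalFun, h2, qone_ne_qtop, letterSection, evalWord, h3]
      · cases w <;>
          simp [spinalFun, h2, qone_ne_qtop, letterSection, evalWord, h3, evalLetter, rootAut,
            rootFun]
    · simp [spinalFun, h1, h2, letterSection, evalWord]

theorem evalWord_apply_nil (m : ℕ) (ω : ℕ → GB →* Equiv.Perm (Fin (m + 2)))
    (F : List (Letter m GB)) : evalWord m ω F [] = [] := by
  induction F with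
  | nil => simp [evalWord]
  | cons x F ih =>
    rw [evalWord_cons, Equiv.Perm.mul_apply, ih]
    cases x <;> simp [evalLetter, rootAut, rootFun, spinalAut, spinalFun]

theorem evalWord_apply_cons (m : ℕ) (ω : ℕ → GB →* Equiv.Perm (Fin (m + 2)))
    (F : List (Letter m GB)) (i : Fin (m + 2)) (w : List (Fin (m + 2))) :
    evalWord m ω F (i :: w) =
      levelPerm F i :: evalWord m (shift ω) (wordSection (ω 0) i F) w := by
  induction F with
  | nil => simp [evalWord, levelPerm, wordSection]
  | cons x F ih =>
    rw [evalWord_cons, Equiv.Perm.mul_apply, ih]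
    rcases x with a | b
    · rfl
    · simp only [wordSection, evalWord_append, Equiv.Perm.mul_apply, levelPerm, evalLetter,
        Sum.elim_inr, spinalAut_cons]

/-- `r`-homogeneity: every `r` consecutive kernels cover `G_B`. -/
def Homogeneous {m : ℕ} (ω : ℕ → GB →* Equiv.Perm (Fin (m + 2))) (r : ℕ) : Prop :=
  ∀ i : ℕ, ∀ b : GB, ∃ j, i ≤ j ∧ j < i + r ∧ ω j b = 1

theorem Homogeneous.shift {m r : ℕ} {ω : ℕ → GB →* Equiv.Perm (Fin (m + 2))}
    (h : Homogeneous ω r) : Homogeneous (shift ω) r := by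
  intro i b
  obtain ⟨j, h1, h2, h3⟩ := h (i + 1) b
  obtain ⟨j, rfl⟩ : ∃ k, j = k + 1 := ⟨j - 1, by omega⟩
  exact ⟨j, by omega, by omega, h3⟩

/-- The (0-based) index of the first homomorphism killing `b`. -/
def killIndex {m : ℕ} (ω : ℕ → GB →* Equiv.Perm (Fin (m + 2))) (b : GB) : ℕ :=
  sInf {j | ω j b = 1}

theorem Homogeneous.killIndex_spec {m r : ℕ} {ω : ℕ → GB →* Equiv.Perm (Fin (m + 2))}
    (h : Homogeneous ω r) (b : GB) : ω (killIndex ω b) b = 1 := by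
  obtain ⟨j, -, -, h3⟩ := h 0 b
  exact Nat.sInf_mem (s := {j | ω j b = 1}) ⟨j, h3⟩

theorem killIndex_le {m j : ℕ} {ω : ℕ → GB →* Equiv.Perm (Fin (m + 2))} {b : GB}
    (h : ω j b = 1) : killIndex ω b ≤ j :=
  Nat.sInf_le h

theorem Homogeneous.killIndex_lt {m r : ℕ} {ω : ℕ → GB →* Equiv.Perm (Fin (m + 2))}
    (h : Homogeneous ω r) (b : GB) : killIndex ω b < r := by
  obtain ⟨j, -, h2, h3⟩ := h 0 b
  exact (killIndex_le h3).trans_lt (by omega)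

theorem Homogeneous.killIndex_shift {m r : ℕ} {ω : ℕ → GB →* Equiv.Perm (Fin (m + 2))}
    (h : Homogeneous ω r) {b : GB} (hb : ω 0 b ≠ 1) :
    killIndex ω b = killIndex (Spinal.shift ω) b + 1 := by
  apply le_antisymm
  · exact killIndex_le (h.shift.killIndex_spec b)
  · have h1 := h.killIndex_spec b
    obtain ⟨k, hk⟩ : ∃ k, killIndex ω b = k + 1 := by
      refine Nat.exists_eq_succ_of_ne_zero fun h0 => hb ?_
      rwa [h0] at h1
    rw [hk] at h1 ⊢
    exact Nat.succ_le_succ (killIndex_le (ω := Spinal.shift ω) h1)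

theorem letterWeight_inr (m : ℕ) (ω : ℕ → GB →* Equiv.Perm (Fin (m + 2))) (η : ℝ) (r : ℕ)
    (b : GB) : letterWeight m ω η r (Sum.inr b) =
      η ^ r + η ^ (r - (killIndex ω b + 1)) - 1 := rfl

section Weights

variable {m r : ℕ} {ω : ℕ → GB →* Equiv.Perm (Fin (m + 2))} {η : ℝ}

theorem letterWeight_inr_le (hη0 : 0 < η) (hη1 : η < 1) (b : GB) :
    letterWeight m ω η r (Sum.inr b) ≤ η ^ r := by
  rw [letterWeight_inr]
  have := pow_le_one₀ (n := r - (killIndex ω b + 1)) hη0.le hη1.le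
  linarith

theorem letterWeight_le_one (hη0 : 0 < η) (hη1 : η < 1) (x : Letter m GB) :
    letterWeight m ω η r x ≤ 1 := by
  rcases x with a | b
  · have := pow_pos hη0 r
    change 1 - η ^ r ≤ 1
    linarith
  · exact (letterWeight_inr_le hη0 hη1 b).trans (pow_le_one₀ hη0.le hη1.le)

theorem le_letterWeight_inr (hη0 : 0 < η) (hη1 : η < 1) {i : ℕ} (b : GB)
    (hi : i ≤ killIndex ω b) :
    η ^ r + η ^ (r - (i + 1)) - 1 ≤ letterWeight m ω η r (Sum.inr b) := by
  rw [letterWeight_inr]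
  have := pow_le_pow_of_le_one hη0.le hη1.le
    (show r - (killIndex ω b + 1) ≤ r - (i + 1) by omega)
  linarith

theorem triangularWeight_pos (hr : 3 ≤ r) (hη0 : 0 < η) (hη1 : η < 1)
    (hroot : η ^ r + η ^ (r - 1) + η ^ (r - 2) = 2) : 0 < η ^ r + η ^ (r - 1) - 1 := by
  have := pow_lt_one₀ hη0.le hη1 (show r - 2 ≠ 0 by omega)
  linarith

theorem exists_pos_le_letterWeight (hr : 3 ≤ r) (hη0 : 0 < η) (hη1 : η < 1)
    (hroot : η ^ r + η ^ (r - 1) + η ^ (r - 2) = 2) :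
    ∃ τ : ℝ, 0 < τ ∧ ∀ (ω : ℕ → GB →* Equiv.Perm (Fin (m + 2))) (x : Letter m GB),
      τ ≤ letterWeight m ω η r x := by
  refine ⟨min (1 - η ^ r) (η ^ r + η ^ (r - 1) - 1), lt_min ?_ ?_, fun ω x => ?_⟩
  · have := pow_lt_one₀ hη0.le hη1 (show r ≠ 0 by omega)
    linarith
  · exact triangularWeight_pos hr hη0 hη1 hroot
  · rcases x with a | b
    · exact min_le_left _ _
    · exact (min_le_right _ _).trans (le_letterWeight_inr hη0 hη1 b (Nat.zero_le _))

theorem letterWeight_mul_le (hω : Homogeneous ω r) (hr : 3 ≤ r) (hη0 : 0 < η) (hη1 : η < 1)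
    (hroot : η ^ r + η ^ (r - 1) + η ^ (r - 2) = 2) (b b' : GB) :
    letterWeight m ω η r (Sum.inr (b * b')) ≤
      letterWeight m ω η r (Sum.inr b) + letterWeight m ω η r (Sum.inr b') := by
  have hpos := triangularWeight_pos hr hη0 hη1 hroot
  have hb := le_letterWeight_inr (r := r) (ω := ω) hη0 hη1 b (Nat.zero_le _)
  have hb' := le_letterWeight_inr (r := r) (ω := ω) hη0 hη1 b' (Nat.zero_le _)
  rw [zero_add] at hb hb'
  have htop := letterWeight_inr_le (m := m) (r := r) (ω := ω) hη0 hη1 (b * b')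
  rcases lt_trichotomy (killIndex ω b) (killIndex ω b') with h | h | h
  · have := le_letterWeight_inr (r := r) (ω := ω) hη0 hη1 (i := 1) b' (by omega)
    norm_num at this
    linarith
  · have hk : killIndex ω (b * b') ≤ killIndex ω b := by
      refine killIndex_le ?_
      rw [map_mul, hω.killIndex_spec b, h, hω.killIndex_spec b', mul_one]
    have := le_letterWeight_inr (r := r) (ω := ω) hη0 hη1 b hk
    rw [← letterWeight_inr] at this
    linarith
  · have := le_letterWeight_inr (r := r) (ω := ω) hη0 hη1 (i := 1) b (by omega)
    norm_num at this
    linarith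

theorem wordWeight_cons (x : Letter m GB) (F : List (Letter m GB)) :
    wordWeight m ω η r (x :: F) = letterWeight m ω η r x + wordWeight m ω η r F := by
  simp [wordWeight]

theorem wordWeight_append (F F' : List (Letter m GB)) :
    wordWeight m ω η r (F ++ F') = wordWeight m ω η r F + wordWeight m ω η r F' := by
  simp [wordWeight]

theorem wordWeight_letterSection (b : GB) (j : Fin (m + 2)) [Decidable (ω 0 b = 1)] :
    wordWeight m (shift ω) η r (letterSection (ω 0) b j) =
      (if j = qtop m then letterWeight m (shift ω) η r (Sum.inr b) else 0) +
        (if j = qone m then (if ω 0 b = 1 then 0 else 1 - η ^ r) else 0) := by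
  have := qone_ne_qtop m
  by_cases h1 : j = qtop m
  · subst h1
    simp [letterSection, wordWeight, this.symm]
  · by_cases h2 : j = qone m <;> by_cases h3 : ω 0 b = 1 <;>
      simp [letterSection, wordWeight, h1, h2, h3, this, letterWeight]

theorem sum_wordWeight_letterSection_le (hω : Homogeneous ω r) (hr : 3 ≤ r) (hη0 : 0 < η)
    (hη1 : η < 1) (b : GB) :
    ∑ j, wordWeight m (shift ω) η r (letterSection (ω 0) b j) ≤
      η * (letterWeight m ω η r (Sum.inr b) + (1 - η ^ r)) := by
  classical
  simp only [wordWeight_letterSection, Finset.sum_add_distrib, Finset.sum_ite_eq',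
    Finset.mem_univ, if_true]
  have hr1 : η * η ^ (r - 1) = η ^ r := by
    rw [← pow_succ']; congr 1; omega
  by_cases h : ω 0 b = 1
  · have h0 : killIndex ω b = 0 := Nat.le_zero.1 (killIndex_le h)
    have := letterWeight_inr_le (m := m) (r := r) (ω := shift ω) hη0 hη1 b
    rw [letterWeight_inr m ω, h0, if_pos h, zero_add]
    linarith
  · have hlt := hω.killIndex_lt b
    rw [letterWeight_inr, letterWeight_inr, if_neg h]
    have hk := hω.killIndex_shift h
    have hpow : η * η ^ (r - (killIndex ω b + 1)) =
        η ^ (r - (killIndex (shift ω) b + 1)) := by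
      rw [← pow_succ']; congr 1; omega
    rw [← hpow]
    apply le_of_eq
    ring

theorem sum_wordWeight_wordSection_le (hω : Homogeneous ω r) (hr : 3 ≤ r) (hη0 : 0 < η)
    (hη1 : η < 1) (F : List (Letter m GB)) :
    ∑ i, wordWeight m (shift ω) η r (wordSection (ω 0) i F) ≤
      η * (wordWeight m ω η r F +
        (((bLetters F).length : ℝ) - (aLetters F).length) * (1 - η ^ r)) := by
  induction F with
  | nil => simp [wordSection, wordWeight, bLetters, aLetters]
  | cons x F ih =>
    rcases x with a | b
    · have h : letterWeight m ω η r (Sum.inl a : Letter m GB) = 1 - η ^ r := rfl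
      have ha : (aLetters (Sum.inl a :: F)).length = (aLetters F).length + 1 := by
        simp [aLetters]
      have hb : bLetters (Sum.inl a :: F) = bLetters F := by simp [bLetters]
      simp only [wordSection]
      rw [wordWeight_cons, ha, hb, h]
      refine ih.trans_eq ?_
      push_cast
      ring
    · have ha : aLetters (Sum.inr b :: F) = aLetters F := by simp [aLetters]
      have hb : (bLetters (Sum.inr b :: F)).length = (bLetters F).length + 1 := by
        simp [bLetters]
      simp only [wordSection, wordWeight_append, Finset.sum_add_distrib]
      have h1 := sum_wordWeight_letterSection_le hω hr hη0 hη1 b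
      have h2 := Equiv.sum_comp (levelPerm F)
        fun j => wordWeight m (shift ω) η r (letterSection (ω 0) b j)
      rw [h2, wordWeight_cons, ha, hb]
      push_cast
      linarith

/-- Merging adjacent `B`-letters yields an equivalent word, of no larger weight, in which the
`B`-letters outnumber the `A`-letters by at most one. -/
theorem exists_balanced_word (hω : Homogeneous ω r) (hr : 3 ≤ r) (hη0 : 0 < η) (hη1 : η < 1)
    (hroot : η ^ r + η ^ (r - 1) + η ^ (r - 2) = 2) (F : List (Letter m GB)) :
    ∃ F' : List (Letter m GB), evalWord m ω F' = evalWord m ω F ∧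
      wordWeight m ω η r F' ≤ wordWeight m ω η r F ∧
      (bLetters F').length ≤ (aLetters F').length + 1 := by
  suffices ∃ F' : List (Letter m GB), evalWord m ω F' = evalWord m ω F ∧
      wordWeight m ω η r F' ≤ wordWeight m ω η r F ∧
      ((bLetters F').length ≤ (aLetters F').length ∨
        ∃ b t, F' = Sum.inr b :: t ∧ (bLetters t).length ≤ (aLetters t).length) by
    obtain ⟨F', h1, h2, h3⟩ := this
    refine ⟨F', h1, h2, ?_⟩
    rcases h3 with h3 | ⟨b, t, rfl, h3⟩
    · omega
    · simpa [bLetters, aLetters] using h3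
  induction F with
  | nil => exact ⟨[], rfl, le_rfl, Or.inl (by simp [bLetters])⟩
  | cons x F ih =>
    obtain ⟨F', h1, h2, h3⟩ := ih
    rcases x with a | b
    · refine ⟨Sum.inl a :: F', ?_, ?_, Or.inl ?_⟩
      · rw [evalWord_cons, evalWord_cons, h1]
      · rw [wordWeight_cons, wordWeight_cons]; linarith
      · rcases h3 with h3 | ⟨b, t, rfl, h3⟩ <;>
          simp only [bLetters, aLetters, List.filterMap_cons, List.length_cons] at h3 ⊢ <;>
          omega
    · rcases h3 with h3 | ⟨b', t, rfl, h3⟩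
      · refine ⟨Sum.inr b :: F', ?_, ?_, Or.inr ⟨b, F', rfl, h3⟩⟩
        · rw [evalWord_cons, evalWord_cons, h1]
        · rw [wordWeight_cons, wordWeight_cons]; linarith
      · refine ⟨Sum.inr (b * b') :: t, ?_, ?_, Or.inr ⟨_, t, rfl, h3⟩⟩
        · rw [evalWord_cons, evalWord_cons, ← h1, evalWord_cons, ← mul_assoc]
          congr 1
          exact spinalAut_mul m ω b b'
        · have := letterWeight_mul_le hω hr hη0 hη1 hroot b b'
          rw [wordWeight_cons] at h2 ⊢
          rw [wordWeight_cons]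
          linarith

end Weights

/-- The least integer upper bound for the weight of a word representing `g`. -/
def intWeight (m : ℕ) (ω : ℕ → GB →* Equiv.Perm (Fin (m + 2))) (η : ℝ) (r : ℕ)
    (g : Equiv.Perm (List (Fin (m + 2)))) : ℕ :=
  sInf {n : ℕ | ∃ F : List (Letter m GB), evalWord m ω F = g ∧ wordWeight m ω η r F ≤ n}

section IntWeight

variable {m r : ℕ} {ω : ℕ → GB →* Equiv.Perm (Fin (m + 2))} {η : ℝ}

theorem intWeight_le {n : ℕ} {F : List (Letter m GB)} (h : wordWeight m ω η r F ≤ n) :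
    intWeight m ω η r (evalWord m ω F) ≤ n :=
  Nat.sInf_le ⟨F, rfl, h⟩

theorem exists_wordWeight_le_intWeight {g : Equiv.Perm (List (Fin (m + 2)))}
    (hg : g ∈ Set.range (evalWord m ω)) :
    ∃ F, evalWord m ω F = g ∧ wordWeight m ω η r F ≤ intWeight m ω η r g := by
  obtain ⟨F, rfl⟩ := hg
  obtain ⟨n, hn⟩ := exists_nat_ge (wordWeight m ω η r F)
  exact Nat.sInf_mem (s := {n : ℕ | ∃ F' : List (Letter m GB),
    evalWord m ω F' = evalWord m ω F ∧ wordWeight m ω η r F' ≤ n}) ⟨n, F, rfl, hn⟩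

theorem wordWeight_nonneg (hr : 3 ≤ r) (hη0 : 0 < η) (hη1 : η < 1)
    (hroot : η ^ r + η ^ (r - 1) + η ^ (r - 2) = 2) (F : List (Letter m GB)) :
    0 ≤ wordWeight m ω η r F := by
  obtain ⟨τ, hτ, h⟩ := exists_pos_le_letterWeight (m := m) (GB := GB) hr hη0 hη1 hroot
  refine List.sum_nonneg fun x hx => ?_
  obtain ⟨y, -, rfl⟩ := List.mem_map.1 hx
  exact hτ.le.trans (h ω y)

/-- An element decomposes into a first-level permutation and sections whose total weight is
contracted by `η`. -/
theorem exists_contracting_decomposition (hω : Homogeneous ω r) (hr : 3 ≤ r) (hη0 : 0 < η)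
    (hη1 : η < 1) (hroot : η ^ r + η ^ (r - 1) + η ^ (r - 2) = 2)
    {g : Equiv.Perm (List (Fin (m + 2)))} (hg : g ∈ Set.range (evalWord m ω)) :
    ∃ t : Equiv.Perm (Fin (m + 2)) × (Fin (m + 2) → Equiv.Perm (List (Fin (m + 2)))),
      (g [] = [] ∧ ∀ i w, g (i :: w) = t.1 i :: t.2 i w) ∧
      (∀ i, t.2 i ∈ Set.range (evalWord m (shift ω))) ∧
      ∑ i, (intWeight m (shift ω) η r (t.2 i) : ℝ) ≤ η * intWeight m ω η r g + (m + 3) := by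
  obtain ⟨F₀, hF₀, hle₀⟩ := exists_wordWeight_le_intWeight (η := η) (r := r) hg
  obtain ⟨F, hF, hle, hbal⟩ := exists_balanced_word hω hr hη0 hη1 hroot F₀
  rw [← hF] at hF₀
  refine ⟨(levelPerm F, fun i => evalWord m (shift ω) (wordSection (ω 0) i F)), ?_, ?_, ?_⟩
  · rw [← hF₀]
    exact ⟨evalWord_apply_nil m ω F, fun i w => evalWord_apply_cons m ω F i w⟩
  · exact fun i => ⟨_, rfl⟩
  · have h1 : ∀ i, (intWeight m (shift ω) η r
        (evalWord m (shift ω) (wordSection (ω 0) i F)) : ℝ) ≤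
        wordWeight m (shift ω) η r (wordSection (ω 0) i F) + 1 := by
      intro i
      have hn := intWeight_le (Nat.le_ceil (wordWeight m (shift ω) η r (wordSection (ω 0) i F)))
      have hc := Nat.ceil_lt_add_one
        (wordWeight_nonneg (ω := shift ω) hr hη0 hη1 hroot (wordSection (ω 0) i F))
      exact (Nat.cast_le.2 hn).trans hc.le
    have h2 := Finset.sum_le_sum fun i (_ : i ∈ Finset.univ) => h1 i
    have h3 := sum_wordWeight_wordSection_le hω hr hη0 hη1 F
    have hbal' : ((bLetters F).length : ℝ) - (aLetters F).length ≤ 1 := by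
      have : ((bLetters F).length : ℝ) ≤ (aLetters F).length + 1 := by exact_mod_cast hbal
      linarith
    have hp := pow_pos hη0 r
    have hp1 := pow_le_one₀ (n := r) hη0.le hη1.le
    have h4 : (((bLetters F).length : ℝ) - (aLetters F).length) * (1 - η ^ r) ≤ 1 := by
      calc _ ≤ 1 * (1 - η ^ r) := mul_le_mul_of_nonneg_right hbal' (by linarith)
        _ ≤ 1 := by linarith
    have h5 : η * (wordWeight m ω η r F +
        (((bLetters F).length : ℝ) - (aLetters F).length) * (1 - η ^ r)) ≤
        η * (intWeight m ω η r g + 1) :=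
      mul_le_mul_of_nonneg_left (by linarith) hη0.le
    simp only [Finset.sum_add_distrib, Finset.sum_const, Finset.card_univ, Fintype.card_fin,
      nsmul_eq_mul, mul_one] at h2
    push_cast at h2
    linarith

theorem exists_card_le_of_intWeight_le [Finite GB] (hr : 3 ≤ r) (hη0 : 0 < η) (hη1 : η < 1)
    (hroot : η ^ r + η ^ (r - 1) + η ^ (r - 2) = 2) (N : ℕ) :
    ∃ L : ℕ, ∀ (ω : ℕ → GB →* Equiv.Perm (Fin (m + 2)))
      (S : Finset (Equiv.Perm (List (Fin (m + 2))))),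
      (∀ g ∈ S, g ∈ Set.range (evalWord m ω) ∧ intWeight m ω η r g ≤ N) → S.card ≤ L := by
  classical
  obtain ⟨τ, hτ, h⟩ := exists_pos_le_letterWeight (m := m) (GB := GB) hr hη0 hη1 hroot
  obtain ⟨K, hK⟩ := exists_nat_ge (N / τ)
  have hfin := List.finite_length_le (Letter m GB) K
  refine ⟨hfin.toFinset.card, fun ω S hS => ?_⟩
  refine (Finset.card_le_card (t := hfin.toFinset.image (evalWord m ω)) ?_).trans
    Finset.card_image_le
  intro g hg
  obtain ⟨hgX, hgN⟩ := hS g hg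
  obtain ⟨F, hF, hle⟩ := exists_wordWeight_le_intWeight (η := η) (r := r) hgX
  refine Finset.mem_image.2 ⟨F, ?_, hF⟩
  have hlen : (F.length : ℝ) * τ ≤ wordWeight m ω η r F := by
    have := List.card_nsmul_le_sum (F.map (letterWeight m ω η r)) τ (by
      intro x hx
      obtain ⟨y, -, rfl⟩ := List.mem_map.1 hx
      exact h ω y)
    simpa [wordWeight] using this
  have hN : (intWeight m ω η r g : ℝ) ≤ N := by exact_mod_cast hgN
  have : (F.length : ℝ) ≤ N / τ := by
    rw [le_div_iff₀ hτ]; linarith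
  simp only [Set.Finite.mem_toFinset, Set.mem_ofPred_eq]
  exact_mod_cast this.trans hK

end IntWeight

theorem inv_mem_genSet {m : ℕ} {GA : Subgroup (Equiv.Perm (Fin (m + 2)))}
    {ω : ℕ → GB →* Equiv.Perm (Fin (m + 2))} {g : Equiv.Perm (List (Fin (m + 2)))}
    (hg : g⁻¹ ∈ genSet m GA ω) : g ∈ genSet m GA ω := by
  obtain ⟨h, hne⟩ := hg
  refine ⟨?_, fun h1 => hne (by rw [Set.mem_singleton_iff] at h1 ⊢; rw [h1, inv_one])⟩
  rcases h with ⟨a, ha, h⟩ | ⟨b, h⟩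
  · refine Or.inl ⟨a⁻¹, inv_mem ha, ?_⟩
    rw [← inv_inj, ← h, inv_eq_iff_mul_eq_one, ← rootAut_mul, inv_mul_cancel, rootAut_one]
  · refine Or.inr ⟨b⁻¹, ?_⟩
    simp only at h ⊢
    rw [← inv_inj, ← h, inv_eq_iff_mul_eq_one, ← spinalAut_mul, inv_mul_cancel, spinalAut_one]

theorem exists_list_of_mem_spinalGroup {m : ℕ} {GA : Subgroup (Equiv.Perm (Fin (m + 2)))}
    {ω : ℕ → GB →* Equiv.Perm (Fin (m + 2))} {g : Equiv.Perm (List (Fin (m + 2)))}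
    (hg : g ∈ spinalGroup m GA ω) :
    ∃ l : List (Equiv.Perm (List (Fin (m + 2)))), l.length = wordLength (genSet m GA ω) g ∧
      (∀ x ∈ l, x ∈ genSet m GA ω) ∧ l.prod = g := by
  rw [spinalGroup, ← Subgroup.mem_toSubmonoid, Subgroup.closure_toSubmonoid] at hg
  obtain ⟨l, hl, hprod⟩ := Submonoid.exists_list_of_mem_closure hg
  exact Nat.sInf_mem (s := {n | ∃ l : List (Equiv.Perm (List (Fin (m + 2)))),
    l.length = n ∧ (∀ x ∈ l, x ∈ genSet m GA ω) ∧ l.prod = g})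
    ⟨_, l, rfl, fun x hx => (hl x hx).elim id inv_mem_genSet, hprod⟩

theorem exists_evalWord_eq_prod {m : ℕ} {GA : Subgroup (Equiv.Perm (Fin (m + 2)))}
    {ω : ℕ → GB →* Equiv.Perm (Fin (m + 2))} (l : List (Equiv.Perm (List (Fin (m + 2)))))
    (hl : ∀ x ∈ l, x ∈ genSet m GA ω) :
    ∃ F : List (Letter m GB), F.length = l.length ∧ evalWord m ω F = l.prod := by
  induction l with
  | nil => exact ⟨[], rfl, rfl⟩
  | cons x l ih =>
    obtain ⟨F, h1, h2⟩ := ih fun y hy => hl y (List.mem_cons_of_mem _ hy)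
    have hx : ∃ y : Letter m GB, evalLetter m ω y = x := by
      rcases (hl x List.mem_cons_self).1 with ⟨a, -, h⟩ | ⟨b, h⟩
      · exact ⟨Sum.inl a, h⟩
      · exact ⟨Sum.inr b, h⟩
    obtain ⟨y, hy⟩ := hx
    exact ⟨y :: F, by simp [h1], by rw [evalWord_cons, h2, hy, List.prod_cons]⟩

theorem intWeight_le_wordLength {m r : ℕ} {GA : Subgroup (Equiv.Perm (Fin (m + 2)))}
    {ω : ℕ → GB →* Equiv.Perm (Fin (m + 2))} {η : ℝ} (hη0 : 0 < η) (hη1 : η < 1)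
    {g : Equiv.Perm (List (Fin (m + 2)))} (hg : g ∈ spinalGroup m GA ω) :
    g ∈ Set.range (evalWord m ω) ∧
      intWeight m ω η r g ≤ wordLength (genSet m GA ω) g := by
  obtain ⟨l, h1, h2, h3⟩ := exists_list_of_mem_spinalGroup hg
  obtain ⟨F, h4, h5⟩ := exists_evalWord_eq_prod l h2
  rw [h3] at h5
  refine ⟨⟨F, h5⟩, ?_⟩
  rw [← h1, ← h4]
  nth_rewrite 1 [← h5]
  refine intWeight_le ?_
  have := List.sum_le_card_nsmul (F.map (letterWeight m ω η r)) 1 (by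
    intro x hx
    obtain ⟨y, -, rfl⟩ := List.mem_map.1 hx
    exact letterWeight_le_one hη0 hη1 y)
  simpa [wordWeight] using this

theorem growth_zero_le_one (m : ℕ) (GA : Subgroup (Equiv.Perm (Fin (m + 2))))
    (ω : ℕ → GB →* Equiv.Perm (Fin (m + 2))) : growth m GA ω 0 ≤ 1 := by
  have h1 : ∀ g : {g : Equiv.Perm (List (Fin (m + 2))) //
      g ∈ spinalGroup m GA ω ∧ wordLength (genSet m GA ω) g ≤ 0}, g.1 = 1 := by
    rintro ⟨g, hg, hle⟩
    obtain ⟨l, h1, -, h3⟩ := exists_list_of_mem_spinalGroup hg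
    rw [Nat.le_zero.1 hle, List.length_eq_zero_iff] at h1
    simp only [← h3, h1, List.prod_nil]
  have : Subsingleton {g : Equiv.Perm (List (Fin (m + 2))) //
      g ∈ spinalGroup m GA ω ∧ wordLength (genSet m GA ω) g ≤ 0} :=
    ⟨fun g g' => Subtype.ext ((h1 g).trans (h1 g').symm)⟩
  exact Finite.card_le_one_iff_subsingleton.2 this

/-- Each element of `G_ω` of length at most `n` contributes at least `exp (-E (3 (n+1)^α - 2))`
to the Kraft sum, which bounds the growth function. -/
theorem exists_growth_le_exp {m r : ℕ} (GA : Subgroup (Equiv.Perm (Fin (m + 2)))) [Finite GB]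
    {ω : ℕ → GB →* Equiv.Perm (Fin (m + 2))} (hω : Homogeneous ω r) (hr : 3 ≤ r) {η α : ℝ}
    (hη0 : 0 < η) (hη1 : η < 1) (hroot : η ^ r + η ^ (r - 1) + η ^ (r - 2) = 2)
    (hα : α = Real.log ((m : ℝ) + 2) / (Real.log ((m : ℝ) + 2) - Real.log η)) :
    ∃ E : ℝ, 0 < E ∧ ∀ n : ℕ,
      (growth m GA ω n : ℝ) ≤ Real.exp (E * (3 * ((n : ℝ) + 1) ^ α - 2)) := by
  classical
  obtain ⟨hα0, -⟩ := rpow_exponent_bounds (q := (m : ℝ) + 2)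
    (by linarith [Nat.cast_nonneg (α := ℝ) m]) hη0 hη1
  rw [← hα] at hα0
  let Ω : ℕ → ℕ → GB →* Equiv.Perm (Fin (m + 2)) := fun k => shift^[k] ω
  have hΩs : ∀ k, Ω (k + 1) = shift (Ω k) := fun k => Function.iterate_succ_apply' _ _ _
  have hΩ : ∀ k, Homogeneous (Ω k) r := by
    intro k
    induction k with
    | zero => exact hω
    | succ k ih => rw [hΩs]; exact ih.shift
  have hex := fun k (g : Equiv.Perm (List (Fin (m + 2))))
      (hg : g ∈ Set.range (evalWord m (Ω k))) =>
    exists_contracting_decomposition (hΩ k) hr hη0 hη1 hroot hg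
  choose! d hd using hex
  obtain ⟨E, hE, hsum⟩ := exists_kraft_inequality (c := (m : ℝ) + 3) hη0 hη1 (by positivity) hα
    (fun k => Set.range (evalWord m (Ω k))) (fun k => intWeight m (Ω k) η r) d
    (by
      intro k g hg g' hg' h
      obtain ⟨⟨h1, h2⟩, -⟩ := hd k g hg
      obtain ⟨⟨h1', h2'⟩, -⟩ := hd k g' hg'
      ext1 w
      cases w with
      | nil => rw [h1, h1']
      | cons i w => rw [h2, h2', h])
    (by
      intro k g hg i
      simp only [hΩs]
      exact (hd k g hg).2.1 i)
    (by
      intro k g hg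
      simp only [hΩs]
      exact (hd k g hg).2.2)
    (by
      intro N
      obtain ⟨L, hL⟩ := exists_card_le_of_intWeight_le (m := m) (GB := GB) hr hη0 hη1 hroot N
      exact ⟨L, fun k S hS => hL (Ω k) S hS⟩)
  refine ⟨E, hE, fun n => ?_⟩
  set T : Set (Equiv.Perm (List (Fin (m + 2)))) :=
    {g | g ∈ spinalGroup m GA ω ∧ wordLength (genSet m GA ω) g ≤ n} with hT
  have hgrowth : growth m GA ω n = T.ncard := rfl
  rcases T.finite_or_infinite with hfin | hinf
  · rw [hgrowth, Set.ncard_eq_toFinset_card T hfin]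
    have hmem : ∀ g ∈ hfin.toFinset, g ∈ Set.range (evalWord m ω) ∧
        intWeight m ω η r g ≤ n := by
      intro g hg
      obtain ⟨h1, h2⟩ := hfin.mem_toFinset.1 hg
      obtain ⟨h3, h4⟩ := intWeight_le_wordLength (r := r) hη0 hη1 h1
      exact ⟨h3, h4.trans h2⟩
    have h0 := hsum 0 hfin.toFinset fun g hg => (hmem g hg).1
    have h1 : (hfin.toFinset.card : ℝ) *
        Real.exp (-(E * (3 * ((n : ℝ) + 1) ^ α - 2))) ≤ 1 := by
      refine le_trans ?_ h0
      rw [← nsmul_eq_mul]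
      refine Finset.card_nsmul_le_sum _ _ _ fun g hg => ?_
      have hle : (intWeight m (Ω 0) η r g : ℝ) ≤ n := by exact_mod_cast (hmem g hg).2
      gcongr
    rwa [Real.exp_neg, ← div_eq_mul_inv, div_le_one (Real.exp_pos _)] at h1
  · rw [hgrowth, hinf.ncard, Nat.cast_zero]
    exact (Real.exp_pos _).le

/-- η-Estimate: if `ω ∈ Ω̂` is `r`-homogeneous (`r ≥ 3`), then
`γ_ω(n) ≾ e^{n^α}` with `α = log q / (log q − log η_r)`, where `η_r` is the unique root
in `(0,1)` of `x^r + x^{r-1} + x^{r-2} - 2`. -/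
theorem spinalGroup_growth_upper_bound_homogeneous (m : ℕ)
    (GA : Subgroup (Equiv.Perm (Fin (m + 2))))
    {GB : Type*} [Group GB] [Finite GB] (ω : ℕ → GB →* Equiv.Perm (Fin (m + 2)))
    (hdata : SpinalData m GA ω) (r : ℕ) (hr : 3 ≤ r)
    (hhom : ∀ i : ℕ, ∀ b : GB, ∃ j, i ≤ j ∧ j < i + r ∧ ω j b = 1)
    (η : ℝ) (hη0 : 0 < η) (hη1 : η < 1)
    (hroot : η ^ r + η ^ (r - 1) + η ^ (r - 2) = 2) :
    ∃ C : ℝ, 0 < C ∧ ∀ n : ℕ,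
      (growth m GA ω n : ℝ) ≤
        Real.exp ((C * n) ^ (Real.log (m + 2) / (Real.log (m + 2) - Real.log η))) := by
  set α : ℝ := Real.log (m + 2) / (Real.log (m + 2) - Real.log η) with hα
  obtain ⟨hα0, -⟩ := rpow_exponent_bounds (q := (m : ℝ) + 2)
    (by linarith [Nat.cast_nonneg (α := ℝ) m]) hη0 hη1
  rw [← hα] at hα0
  obtain ⟨E, hE, h⟩ := exists_growth_le_exp GA hhom hr hη0 hη1 hroot hα
  refine ⟨2 * (3 * E) ^ α⁻¹, by positivity, fun n => ?_⟩
  rcases Nat.eq_zero_or_pos n with rfl | hn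
  · rw [Nat.cast_zero, mul_zero, Real.zero_rpow hα0.ne', Real.exp_zero]
    exact_mod_cast growth_zero_le_one m GA ω
  · refine (h n).trans (Real.exp_le_exp.2 ?_)
    have hn1 : (1 : ℝ) ≤ n := by exact_mod_cast hn
    have hpow : ((n : ℝ) + 1) ^ α ≤ (2 * n) ^ α :=
      Real.rpow_le_rpow (by linarith) (by linarith) hα0.le
    have hrw : (2 * (3 * E) ^ α⁻¹ * n) ^ α = 3 * E * (2 * n) ^ α := by
      rw [show 2 * (3 * E) ^ α⁻¹ * (n : ℝ) = (3 * E) ^ α⁻¹ * (2 * n) by ring,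
        Real.mul_rpow (by positivity) (by positivity), Real.rpow_inv_rpow (by positivity) hα0.ne']
    rw [hrw]
    have := mul_le_mul_of_nonneg_left hpow hE.le
    linarith
end Spinal
end
end

section
/- Let q = 2 and let ω ∈ Ω̂ be a sequence such that there exist indices 1 ≤ k < ℓ < m ≤ r with Ker(ω_k) ∪ Ker(ω_ℓ) ∪ Ker(ω_m) = G_B. Then for every reduced word F over S_ω representing an element of H_ω^{(r)}, the total length of level r of the depth-r decomposition of F satisfies |L_r(F)| < (2/3)·|F| + 2/3 + 3·q^r. -/
noncomputable section

open Equiv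

namespace Spinal

variable {GB : Type*} [Group GB]

/-- The total weight of a word for a weight function on letters. -/
def totalWeight {m : ℕ} (w : Letter m GB → ℕ) (F : List (Letter m GB)) : ℕ :=
  (F.map w).sum

open scoped Classical in
/-- The weight counting non-identity `A`-letters. -/
def aWeight {m : ℕ} : Letter m GB → ℕ :=
  Sum.elim (fun a => if a = 1 then 0 else 1) fun _ => 0

/-- The weight counting `B`-letters. -/
def bWeight {m : ℕ} : Letter m GB → ℕ :=
  Sum.elim (fun _ => 0) fun _ => 1

open scoped Classical in
/-- The weight counting `B`-letters outside the kernel of `φ`. -/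
def coKerWeight {m : ℕ} (φ : GB →* Equiv.Perm (Fin (m + 2))) : Letter m GB → ℕ :=
  Sum.elim (fun _ => 0) fun b => if φ b = 1 then 0 else 1

/-- Weights that do not increase when two letters of the same type are multiplied. -/
structure IsSubadditive {m : ℕ} (w : Letter m GB → ℕ) : Prop where
  inl_mul : ∀ a a', w (Sum.inl (a * a')) ≤ w (Sum.inl a) + w (Sum.inl a')
  inr_mul : ∀ b b', w (Sum.inr (b * b')) ≤ w (Sum.inr b) + w (Sum.inr b')

theorem isSubadditive_aWeight {m : ℕ} : IsSubadditive (aWeight : Letter m GB → ℕ) where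
  inl_mul a a' := by
    by_cases h : a = 1 <;> by_cases h' : a' = 1 <;> simp [aWeight, h, h']
    split_ifs <;> omega
  inr_mul b b' := by simp [aWeight]

theorem isSubadditive_bWeight {m : ℕ} : IsSubadditive (bWeight : Letter m GB → ℕ) where
  inl_mul a a' := by simp [bWeight]
  inr_mul b b' := by simp [bWeight]

theorem isSubadditive_coKerWeight {m : ℕ} (φ : GB →* Equiv.Perm (Fin (m + 2))) :
    IsSubadditive (coKerWeight φ) where
  inl_mul a a' := by simp [coKerWeight]
  inr_mul b b' := by
    by_cases h : φ b = 1 <;> by_cases h' : φ b' = 1 <;> simp [coKerWeight, h, h']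
    split_ifs <;> omega

theorem totalWeight_reduceStep_le {m : ℕ} {w : Letter m GB → ℕ} (hw : IsSubadditive w)
    (x : Letter m GB) (F : List (Letter m GB)) :
    totalWeight w (reduceStep x F) ≤ w x + totalWeight w F := by
  rcases x with a | b <;> rcases F with _ | ⟨a' | b', t⟩ <;>
    simp only [reduceStep] <;> split_ifs <;> simp [totalWeight]
  · omega
  · linarith [hw.inl_mul a a']
  · omega
  · linarith [hw.inr_mul b b']

theorem totalWeight_reduceWord_le {m : ℕ} {w : Letter m GB → ℕ} (hw : IsSubadditive w)
    (F : List (Letter m GB)) : totalWeight w (reduceWord F) ≤ totalWeight w F := by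
  induction F with
  | nil => simp [reduceWord]
  | cons x F ih =>
    exact (totalWeight_reduceStep_le hw x _).trans (Nat.add_le_add_left ih _)

theorem isReduced_iff {m : ℕ} (F : List (Letter m GB)) :
    IsReduced F ↔ List.IsChain (fun x y => x.isLeft ≠ y.isLeft) F ∧
      Sum.inl (1 : Equiv.Perm (Fin (m + 2))) ∉ F ∧ Sum.inr (1 : GB) ∉ F :=
  Iff.rfl

theorem IsReduced.tail {m : ℕ} {x : Letter m GB} {F : List (Letter m GB)}
    (h : IsReduced (x :: F)) : IsReduced F :=
  ⟨List.IsChain.tail h.1, fun h' => h.2.1 (List.mem_cons_of_mem _ h'),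
    fun h' => h.2.2 (List.mem_cons_of_mem _ h')⟩

theorem isReduced_reduceStep {m : ℕ} (x : Letter m GB) {F : List (Letter m GB)}
    (hF : IsReduced F) : IsReduced (reduceStep x F) := by
  rcases x with a | b <;> rcases F with _ | ⟨a' | b', t⟩ <;>
    simp only [reduceStep] <;> split_ifs with h
  all_goals first
    | exact hF
    | exact hF.tail
    | (replace h := Ne.symm h
       rw [isReduced_iff] at hF ⊢
       rcases t with _ | ⟨y, t⟩ <;> simp_all)
    | (replace h := Ne.symm h
       simp_all [isReduced_iff])

theorem isReduced_reduceWord {m : ℕ} (F : List (Letter m GB)) : IsReduced (reduceWord F) := by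
  induction F with
  | nil => simp [reduceWord, isReduced_iff]
  | cons x F ih => exact isReduced_reduceStep x ih

theorem IsReduced.weights {m : ℕ} : ∀ {F : List (Letter m GB)}, IsReduced F →
    F.length = totalWeight aWeight F + totalWeight bWeight F ∧
      totalWeight aWeight F ≤ totalWeight bWeight F + 1 ∧
      totalWeight bWeight F ≤ totalWeight aWeight F + 1
  | [], _ => by simp [totalWeight]
  | [x], h => by
    rcases x with a | b
    · have : a ≠ 1 := by rintro rfl; exact h.2.1 (by simp)
      simp [totalWeight, aWeight, bWeight, this]
    · simp [totalWeight, aWeight, bWeight]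
  | x :: y :: t, h => by
    have ih := IsReduced.weights h.tail.tail
    have hxy : x.isLeft ≠ y.isLeft := (List.isChain_cons_cons.1 h.1).1
    have h1 := h.2.1
    rcases x with a | b <;> rcases y with a' | b' <;> simp at hxy
    all_goals
      simp only [List.mem_cons, Sum.inl.injEq, reduceCtorEq, false_or, not_or] at h1
      simp only [totalWeight, List.map_cons, List.sum_cons, List.length_cons, aWeight, bWeight,
        Sum.elim_inl, Sum.elim_inr, Ne.symm h1.1, if_false] at ih ⊢
      omega

theorem sum_totalWeight_projWord {m : ℕ} (w : Letter m GB → ℕ)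
    (ω0 : GB →* Equiv.Perm (Fin (m + 2))) (F : List (Letter m GB))
    (g : Equiv.Perm (Fin (m + 2))) :
    ∑ i, totalWeight w (projWord m ω0 i F g) =
      totalWeight (Sum.elim (fun _ => 0) fun b => w (Sum.inr b) + w (Sum.inl (ω0 b))) F := by
  induction F generalizing g with
  | nil => simp [projWord, totalWeight]
  | cons x F ih =>
    rcases x with a | b
    · simpa [projWord, totalWeight] using ih (g * a)
    · have key : ∀ i, totalWeight w (projWord m ω0 i (Sum.inr b :: F) g) =
          (if g (qtop m) = i then w (Sum.inr b) else 0) +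
            (if g (qone m) = i then w (Sum.inl (ω0 b)) else 0) +
            totalWeight w (projWord m ω0 i F g) := by
        intro i
        simp only [projWord, totalWeight, List.map_append, List.sum_append]
        split_ifs <;> simp
      simp only [key, Finset.sum_add_distrib, ih]
      simp [totalWeight]

/-- The word at the vertex `i` of the first level of the decomposition of `F`. -/
def childWord (m : ℕ) (ω0 : GB →* Equiv.Perm (Fin (m + 2))) (F : List (Letter m GB))
    (i : Fin (m + 2)) : List (Letter m GB) :=
  reduceWord (projWord m ω0 i F 1)

theorem sum_totalWeight_childWord_le {m : ℕ} {w : Letter m GB → ℕ} (hw : IsSubadditive w)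
    (ω0 : GB →* Equiv.Perm (Fin (m + 2))) (F : List (Letter m GB)) :
    ∑ i, totalWeight w (childWord m ω0 F i) ≤
      totalWeight (Sum.elim (fun _ => 0) fun b => w (Sum.inr b) + w (Sum.inl (ω0 b))) F :=
  (Finset.sum_le_sum fun _ _ => totalWeight_reduceWord_le hw _).trans
    (sum_totalWeight_projWord w ω0 F 1).le

theorem sum_bWeight_childWord_le {m : ℕ} (ω0 : GB →* Equiv.Perm (Fin (m + 2)))
    (F : List (Letter m GB)) :
    ∑ i, totalWeight bWeight (childWord m ω0 F i) ≤ totalWeight bWeight F :=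
  sum_totalWeight_childWord_le isSubadditive_bWeight ω0 F

theorem sum_coKerWeight_childWord_le {m : ℕ} (ω0 φ : GB →* Equiv.Perm (Fin (m + 2)))
    (F : List (Letter m GB)) :
    ∑ i, totalWeight (coKerWeight φ) (childWord m ω0 F i) ≤ totalWeight (coKerWeight φ) F :=
  sum_totalWeight_childWord_le (isSubadditive_coKerWeight φ) ω0 F

theorem sum_aWeight_childWord_le {m : ℕ} (ω0 : GB →* Equiv.Perm (Fin (m + 2)))
    (F : List (Letter m GB)) :
    ∑ i, totalWeight aWeight (childWord m ω0 F i) ≤ totalWeight (coKerWeight ω0) F := by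
  refine (sum_totalWeight_childWord_le isSubadditive_aWeight ω0 F).trans (le_of_eq ?_)
  congr 1
  ext (a | b) <;> simp [aWeight, coKerWeight]

theorem levelLength_succ (m : ℕ) (ω : ℕ → GB →* Equiv.Perm (Fin (m + 2))) (r : ℕ)
    (F : List (Letter m GB)) :
    levelLength m ω (r + 1) F =
      ∑ i, levelLength m (fun n => ω (n + 1)) r (childWord m (ω 0) F i) := by
  simp only [levelLength, levelWords, childWord, Fin.sum_univ_def, List.map_flatMap]
  generalize List.finRange (m + 2) = L
  induction L with
  | nil => rfl
  | cons i L ih => simp [ih]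

theorem levelLength_le_bWeight {m : ℕ} (r : ℕ) (ω : ℕ → GB →* Equiv.Perm (Fin (m + 2)))
    {F : List (Letter m GB)} (hF : IsReduced F) :
    levelLength m ω r F ≤ 2 * totalWeight bWeight F + (m + 2) ^ r := by
  induction r generalizing ω F with
  | zero =>
    have := hF.weights
    simp only [levelLength, levelWords, List.map_cons, List.map_nil, List.sum_cons,
      List.sum_nil, pow_zero]
    omega
  | succ r ih =>
    rw [levelLength_succ]
    calc _ ≤ ∑ i, (2 * totalWeight bWeight (childWord m (ω 0) F i) + (m + 2) ^ r) :=
          Finset.sum_le_sum fun i _ => ih _ (isReduced_reduceWord _)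
      _ = 2 * ∑ i, totalWeight bWeight (childWord m (ω 0) F i) + (m + 2) ^ (r + 1) := by
          simp [Finset.sum_add_distrib, Finset.mul_sum, pow_succ, mul_comm]
      _ ≤ _ := by have := sum_bWeight_childWord_le (ω 0) F; omega

theorem levelLength_le_aWeight {m : ℕ} (r : ℕ) (ω : ℕ → GB →* Equiv.Perm (Fin (m + 2)))
    {F : List (Letter m GB)} (hF : IsReduced F) :
    levelLength m ω r F ≤ 2 * totalWeight aWeight F + 2 * (m + 2) ^ r := by
  have h := hF.weights
  rcases r with _ | r
  · simp only [levelLength, levelWords, List.map_cons, List.map_nil, List.sum_cons,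
      List.sum_nil, pow_zero]
    omega
  · have h1 := levelLength_le_bWeight (r + 1) ω hF
    have h2 : 2 ≤ (m + 2) ^ (r + 1) := by
      have := Nat.le_self_pow (Nat.add_one_ne_zero r) (m + 2)
      omega
    omega

theorem levelLength_le_coKerWeight {m : ℕ} {r i : ℕ} (hi : i < r)
    (ω : ℕ → GB →* Equiv.Perm (Fin (m + 2))) (F : List (Letter m GB)) :
    levelLength m ω r F ≤ 2 * totalWeight (coKerWeight (ω i)) F + 2 * (m + 2) ^ r := by
  obtain ⟨r, rfl⟩ := Nat.exists_eq_add_one_of_ne_zero (Nat.ne_zero_of_lt hi)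
  have bound (w : Letter m GB → ℕ)
      (hle : ∀ j, levelLength m (fun n => ω (n + 1)) r (childWord m (ω 0) F j) ≤
        2 * totalWeight w (childWord m (ω 0) F j) + 2 * (m + 2) ^ r)
      (hsum : ∑ j, totalWeight w (childWord m (ω 0) F j) ≤
        totalWeight (coKerWeight (ω i)) F) :
      levelLength m ω (r + 1) F ≤
        2 * totalWeight (coKerWeight (ω i)) F + 2 * (m + 2) ^ (r + 1) := by
    rw [levelLength_succ]
    calc _ ≤ ∑ j, (2 * totalWeight w (childWord m (ω 0) F j) + 2 * (m + 2) ^ r) :=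
          Finset.sum_le_sum fun j _ => hle j
      _ = 2 * ∑ j, totalWeight w (childWord m (ω 0) F j) + 2 * (m + 2) ^ (r + 1) := by
          simp only [Finset.sum_add_distrib, Finset.mul_sum, Finset.sum_const,
            Finset.card_univ, Fintype.card_fin, smul_eq_mul]
          ring
      _ ≤ _ := by omega
  rcases i with _ | i
  · exact bound aWeight (fun _ => levelLength_le_aWeight r _ (isReduced_reduceWord _))
      (sum_aWeight_childWord_le _ F)
  · exact bound _ (fun _ => levelLength_le_coKerWeight (Nat.lt_of_succ_lt_succ hi) _ _)
      (sum_coKerWeight_childWord_le _ _ F)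

theorem coKerWeight_add_add_le {m : ℕ} {φ ψ χ : GB →* Equiv.Perm (Fin (m + 2))}
    (hcover : ∀ b, φ b = 1 ∨ ψ b = 1 ∨ χ b = 1) (F : List (Letter m GB)) :
    totalWeight (coKerWeight φ) F + totalWeight (coKerWeight ψ) F +
      totalWeight (coKerWeight χ) F ≤ 2 * totalWeight bWeight F := by
  simp only [totalWeight, ← List.sum_map_add, ← List.sum_map_mul_left]
  refine List.sum_le_sum fun x _ => ?_
  rcases x with a | b
  · simp [coKerWeight]
  · simp only [coKerWeight, bWeight, Sum.elim_inr]
    rcases hcover b with h | h | h <;> rw [if_pos h] <;> split_ifs <;> omega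

/-- 2/3-Shortening: let `q = 2` and `ω ∈ Ω̂` admit indices `k < ℓ < m ≤ r` (1-based; here
0-based `k < l < m' < r`) with `Ker ω_k ∪ Ker ω_ℓ ∪ Ker ω_m = G_B`. Then for every
reduced word `F` over `S_ω` representing an element of `H_ω^{(r)}`,
`|L_r(F)| < (2/3)·|F| + 2/3 + 3·q^r`. -/
theorem two_thirds_shortening (GA : Subgroup (Equiv.Perm (Fin (0 + 2))))
    {GB : Type*} [Group GB] [Finite GB] (ω : ℕ → GB →* Equiv.Perm (Fin (0 + 2)))
    (hdata : SpinalData 0 GA ω) (r k l m' : ℕ)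
    (hkl : k < l) (hlm : l < m') (hmr : m' < r)
    (hcover : ∀ b : GB, ω k b = 1 ∨ ω l b = 1 ∨ ω m' b = 1)
    (F : List (Letter 0 GB)) (hred : IsReduced F)
    (hA : ∀ a : Equiv.Perm (Fin (0 + 2)), Sum.inl a ∈ F → a ∈ GA)
    (hstab : ∀ w : List (Fin (0 + 2)), w.length = r → (F.map (evalLetter 0 ω)).prod w = w) :
    (levelLength 0 ω r F : ℝ) < 2 / 3 * F.length + 2 / 3 + 3 * (2 : ℝ) ^ r := by
  have h1 := levelLength_le_coKerWeight (hkl.trans (hlm.trans hmr)) ω F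
  have h2 := levelLength_le_coKerWeight (hlm.trans hmr) ω F
  have h3 := levelLength_le_coKerWeight hmr ω F
  have h4 := coKerWeight_add_add_le hcover F
  have h5 := hred.weights
  have hpow : 0 < (0 + 2) ^ r := by positivity
  have key : 3 * levelLength 0 ω r F < 2 * F.length + 2 + 9 * (0 + 2) ^ r := by omega
  have key' : (3 * levelLength 0 ω r F : ℝ) < 2 * F.length + 2 + 9 * (2 : ℝ) ^ r := by
    exact_mod_cast key
  linarith
end Spinal
end
end
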